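/- If N is a finite-index subgroup of index k in a free group of rank r, then N is free of rank 1 + k(r − 1) (Schreier index formula). -/

import Mathlib

/-- A (nonabelian) cocycle for the action of `G` on `X` with values in `H`. -/
def SchreierCocycle {G X H : Type} [Group G] [MulAction G X] [Group H] (c : G → X → H) : Prop :=
  ∀ g h x, c (g * h) x = c g (h • x) * c h x

namespace SchreierCocycle

variable {G X H : Type} [Group G] [MulAction G X] [Group H] {c d : G → X → H}

theorem map_one (hc : SchreierCocycle c) (x : X) : c 1 x = 1 := by
  have := hc 1 1 x
  simpa using this

theorem map_inv (hc : SchreierCocycle c) (g : G) (x : X) : c g⁻¹ x = (c g (g⁻¹ • x))⁻¹ := by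
  have := hc g g⁻¹ x
  rw [mul_inv_cancel, hc.map_one] at this
  exact (inv_eq_of_mul_eq_one_right this.symm).symm

theorem ext_free {ι X H : Type} [MulAction (FreeGroup ι) X] [Group H]
    {c d : FreeGroup ι → X → H} (hc : SchreierCocycle c) (hd : SchreierCocycle d)
    (h : ∀ i x, c (FreeGroup.of i) x = d (FreeGroup.of i) x) (g : FreeGroup ι) :
    ∀ x, c g x = d g x := by
  induction g using FreeGroup.induction_on with
  | C1 => intro x; rw [hc.map_one, hd.map_one]
  | of i => exact h i
  | inv_of i ih => intro x; rw [hc.map_inv, hd.map_inv, h]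
  | mul a b ha hb => intro x; rw [hc, hd, ha, hb]

theorem exists_free {ι X H : Type} [MulAction (FreeGroup ι) X] [Group H]
    (f : ι → X → H) : ∃ c : FreeGroup ι → X → H, SchreierCocycle c ∧
      ∀ i x, c (FreeGroup.of i) x = f i x := by
  let F : FreeGroup ι →* (X → H) ⋊[mulAutArrow] FreeGroup ι :=
    FreeGroup.lift fun i => ⟨fun y => f i ((FreeGroup.of i)⁻¹ • y), FreeGroup.of i⟩
  have hF : ∀ g, (F g).right = g := by
    intro g
    have : SemidirectProduct.rightHom.comp F = MonoidHom.id _ := by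
      ext i
      simp [F]
    exact DFunLike.congr_fun this g
  refine ⟨fun g x => (F g).left (g • x), ?_, ?_⟩
  · intro g h x
    have : ∀ (a : FreeGroup ι) (u : X → H) (y : X), (mulAutArrow a u) y = u (a⁻¹ • y) :=
      fun _ _ _ => rfl
    simp only [map_mul, SemidirectProduct.mul_left, Pi.mul_apply, hF, this, mul_smul,
      inv_smul_smul]
  · intro i x
    simp [F]

end SchreierCocycle

/-- A partial spanning tree for the Schreier graph, with `n + 1` vertices. -/
theorem schreier_tree {ι X : Type} [Fintype X] [DecidableEq X] [DecidableEq ι]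
    [MulAction (FreeGroup ι) X]
    [MulAction.IsPretransitive (FreeGroup ι) X] (x0 : X) (n : ℕ) (hn : n + 1 ≤ Fintype.card X) :
    ∃ (A : Finset X) (T : Finset (ι × X)) (t : X → FreeGroup ι),
      A.card = n + 1 ∧ T.card = n ∧ x0 ∈ A ∧ t x0 = 1 ∧ (∀ x ∈ A, t x • x0 = x) ∧
      (∀ e ∈ T, e.2 ∈ A ∧ FreeGroup.of e.1 • e.2 ∈ A ∧
        t (FreeGroup.of e.1 • e.2) = FreeGroup.of e.1 * t e.2) ∧
      (∀ (H : Type) [Group H] (c : FreeGroup ι → X → H), SchreierCocycle c →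
        (∀ e ∈ T, c (FreeGroup.of e.1) e.2 = 1) → ∀ x ∈ A, c (t x) x0 = 1) := by
  induction n with
  | zero =>
    refine ⟨{x0}, ∅, fun _ => 1, by simp, by simp, by simp, rfl, by simp, by simp, ?_⟩
    intro H _ c hc _ x _
    exact hc.map_one _
  | succ n ih =>
    obtain ⟨A, T, t, hA, hT, hx0, ht0, ht, hTA, hc⟩ := ih (by omega)
    have key : ∃ i : ι, ∃ y : X, ¬ (y ∈ A ↔ FreeGroup.of i • y ∈ A) := by
      by_contra hcon
      push Not at hcon
      have inv : ∀ g : FreeGroup ι, ∀ y, y ∈ A ↔ g • y ∈ A := by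
        intro g
        induction g using FreeGroup.induction_on with
        | C1 => simp
        | of i => exact hcon i
        | inv_of i ih => intro y; rw [hcon i ((FreeGroup.of i)⁻¹ • y), smul_inv_smul]
        | mul a b ha hb => intro y; rw [hb, ha, mul_smul]
      have : A = Finset.univ := by
        ext y
        obtain ⟨g, rfl⟩ := MulAction.exists_smul_eq (FreeGroup ι) x0 y
        simp [← inv g x0, hx0]
      rw [this, Finset.card_univ] at hA
      omega
    obtain ⟨i, y, hy⟩ := key
    -- the new edge is `(i, y)`, not in `T`
    have hnT : (i, y) ∉ T := by
      intro h
      have := hTA _ h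
      exact hy ⟨fun _ => this.2.1, fun _ => this.1⟩
    by_cases hyA : y ∈ A
    · have hz : FreeGroup.of i • y ∉ A := fun h => hy ⟨fun _ => h, fun _ => hyA⟩
      have hne : ∀ x ∈ A, x ≠ FreeGroup.of i • y := fun x hx h => hz (h ▸ hx)
      refine ⟨insert (FreeGroup.of i • y) A, insert (i, y) T,
        Function.update t (FreeGroup.of i • y) (FreeGroup.of i * t y), ?_, ?_, ?_, ?_, ?_, ?_, ?_⟩
      · rw [Finset.card_insert_of_notMem hz, hA]
      · rw [Finset.card_insert_of_notMem hnT, hT]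
      · simp [hx0]
      · rw [Function.update_of_ne (hne _ hx0), ht0]
      · intro x hx
        rcases Finset.mem_insert.1 hx with rfl | hx
        · rw [Function.update_self, mul_smul, ht _ hyA]
        · rw [Function.update_of_ne (hne _ hx), ht _ hx]
      · intro e he
        rcases Finset.mem_insert.1 he with rfl | he
        · refine ⟨by simp [hyA], by simp, ?_⟩
          rw [Function.update_self, Function.update_of_ne (hne _ hyA)]
        · obtain ⟨h1, h2, h3⟩ := hTA e he
          refine ⟨by simp [h1], by simp [h2], ?_⟩
          rw [Function.update_of_ne (hne _ h1), Function.update_of_ne (hne _ h2), h3]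
      · intro H _ c hcc hcT x hx
        have old := hc H c hcc (fun e he => hcT e (Finset.mem_insert_of_mem he))
        rcases Finset.mem_insert.1 hx with rfl | hx
        · rw [Function.update_self, hcc, ht _ hyA, old _ hyA,
            hcT (i, y) (Finset.mem_insert_self _ _), one_mul]
        · rw [Function.update_of_ne (hne _ hx), old _ hx]
    · have hw : FreeGroup.of i • y ∈ A := by
        by_contra h
        exact hy ⟨fun h' => absurd h' hyA, fun h' => absurd h' h⟩
      have hne : ∀ x ∈ A, x ≠ y := fun x hx h => hyA (h ▸ hx)
      refine ⟨insert y A, insert (i, y) T,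
        Function.update t y ((FreeGroup.of i)⁻¹ * t (FreeGroup.of i • y)),
        ?_, ?_, ?_, ?_, ?_, ?_, ?_⟩
      · rw [Finset.card_insert_of_notMem hyA, hA]
      · rw [Finset.card_insert_of_notMem hnT, hT]
      · simp [hx0]
      · rw [Function.update_of_ne (hne _ hx0), ht0]
      · intro x hx
        rcases Finset.mem_insert.1 hx with rfl | hx
        · rw [Function.update_self, mul_smul, ht _ hw, inv_smul_smul]
        · rw [Function.update_of_ne (hne _ hx), ht _ hx]
      · intro e he
        rcases Finset.mem_insert.1 he with rfl | he
        · refine ⟨by simp, by simp [hw], ?_⟩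
          rw [Function.update_self, Function.update_of_ne (hne _ hw), mul_inv_cancel_left]
        · obtain ⟨h1, h2, h3⟩ := hTA e he
          refine ⟨by simp [h1], by simp [h2], ?_⟩
          rw [Function.update_of_ne (hne _ h1), Function.update_of_ne (hne _ h2), h3]
      · intro H _ c hcc hcT x hx
        have old := hc H c hcc (fun e he => hcT e (Finset.mem_insert_of_mem he))
        rcases Finset.mem_insert.1 hx with rfl | hx
        · rw [Function.update_self, hcc, ht _ hw, old _ hw, hcc.map_inv, inv_smul_smul,
            hcT (i, x) (Finset.mem_insert_self _ _), inv_one, one_mul]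
        · rw [Function.update_of_ne (hne _ hx), old _ hx]

/-- The stabilizer of a point for a transitive action of a free group is free on the edges of
the Schreier graph outside a spanning tree. -/
theorem schreier_stabilizer {ι X : Type} [Fintype X] [DecidableEq X] [DecidableEq ι]
    [MulAction (FreeGroup ι) X]
    [MulAction.IsPretransitive (FreeGroup ι) X] (x0 : X) :
    ∃ T : Finset (ι × X), T.card + 1 = Fintype.card X ∧
      Nonempty (FreeGroup {e : ι × X // e ∉ T} ≃* MulAction.stabilizer (FreeGroup ι) x0) := by
  have hpos : 0 < Fintype.card X := Fintype.card_pos_iff.2 ⟨x0⟩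
  obtain ⟨A, T, t, hA, hT, -, ht0, ht, hTA, hc⟩ :=
    schreier_tree (ι := ι) x0 (Fintype.card X - 1) (by omega)
  have hAu : A = Finset.univ := by
    rw [← Finset.card_eq_iff_eq_univ]; omega
  subst hAu
  refine ⟨T, by omega, ?_⟩
  let N := MulAction.stabilizer (FreeGroup ι) x0
  have ht' : ∀ x, t x • x0 = x := fun x => ht x (Finset.mem_univ _)
  -- the tautological cocycle with values in the stabilizer
  let d : FreeGroup ι → X → N := fun g x =>
    ⟨(t (g • x))⁻¹ * g * t x, by
      rw [MulAction.mem_stabilizer_iff, mul_smul, mul_smul, ht', inv_smul_eq_iff, ht']⟩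
  have hd : SchreierCocycle d := by
    intro g h x
    apply Subtype.ext
    simp only [d, Subgroup.coe_mul, mul_smul]
    group
  obtain ⟨c, hcc, hcf⟩ := SchreierCocycle.exists_free
    (fun (i : ι) (x : X) => if h : (i, x) ∈ T then (1 : FreeGroup {e : ι × X // e ∉ T})
      else FreeGroup.of ⟨(i, x), h⟩)
  have hct : ∀ x, c (t x) x0 = 1 := fun x =>
    hc _ c hcc (fun e he => by rw [hcf, dif_pos he]) x (Finset.mem_univ _)
  let φ : FreeGroup {e : ι × X // e ∉ T} →* N :=
    FreeGroup.lift fun e => d (FreeGroup.of e.1.1) e.1.2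
  let ψ : N →* FreeGroup {e : ι × X // e ∉ T} :=
    { toFun := fun n => c n x0
      map_one' := hcc.map_one _
      map_mul' := fun a b => by
        rw [Subgroup.coe_mul, hcc, MulAction.mem_stabilizer_iff.1 b.2] }
  have hφ : ∀ g x, φ (c g x) = d g x := by
    intro g
    refine SchreierCocycle.ext_free (c := fun g x => φ (c g x)) ?_ hd ?_ g
    · intro g h x
      simp only [hcc g h x, map_mul]
    · intro i x
      simp only [hcf]
      split_ifs with h
      · rw [map_one]
        apply Subtype.ext
        simp only [d, (hTA _ h).2.2]
        simp
      · simp [φ]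
  refine ⟨MonoidHom.toMulEquiv φ ψ ?_ ?_⟩
  · ext e
    change c ((φ (FreeGroup.of e) : N) : FreeGroup ι) x0 = FreeGroup.of e
    obtain ⟨⟨i, x⟩, he⟩ := e
    simp only [φ, FreeGroup.lift_apply_of, d]
    rw [mul_assoc, hcc, hcc, hct, ht', mul_one, hcc.map_inv, mul_smul, ht', hcf, dif_neg he]
    rw [show (t (FreeGroup.of i • x))⁻¹ • FreeGroup.of i • x = x0 by
      rw [inv_smul_eq_iff, ht'], hct, inv_one, one_mul]
  · ext n
    change ((φ (c n x0) : N) : FreeGroup ι) = n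
    rw [hφ]
    simp only [d, MulAction.mem_stabilizer_iff.1 n.2, ht0]
    simp

/-- Schreier index formula: a subgroup of index k in a free group of rank r is
free of rank 1 + k(r − 1). -/
theorem schreier_index_formula (r k : ℕ) (hk : k ≠ 0)
    (N : Subgroup (FreeGroup (Fin r))) (hN : N.index = k) :
    ∃ m : ℕ, (m : ℤ) = 1 + (k : ℤ) * ((r : ℤ) - 1) ∧
      Nonempty (FreeGroup (Fin m) ≃* N) := by
  classical
  have hfin : Finite (FreeGroup (Fin r) ⧸ N) :=
    Nat.finite_of_card_ne_zero (by rw [← Subgroup.index_eq_card, hN]; exact hk)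
  have := Fintype.ofFinite (FreeGroup (Fin r) ⧸ N)
  obtain ⟨T, hT, ⟨e⟩⟩ := schreier_stabilizer (ι := Fin r)
    (((1 : FreeGroup (Fin r)) : FreeGroup (Fin r) ⧸ N))
  have hX : Fintype.card (FreeGroup (Fin r) ⧸ N) = k := by
    rw [← Nat.card_eq_fintype_card, ← Subgroup.index_eq_card, hN]
  rw [MulAction.stabilizer_quotient] at e
  refine ⟨Fintype.card {e : Fin r × (FreeGroup (Fin r) ⧸ N) // e ∉ T}, ?_,
    ⟨(FreeGroup.freeGroupCongr (Fintype.equivFin _)).symm.trans e⟩⟩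
  have h1 : Fintype.card {e : Fin r × (FreeGroup (Fin r) ⧸ N) // e ∉ T} + T.card = r * k := by
    have h2 := Fintype.card_subtype_compl (fun e : Fin r × (FreeGroup (Fin r) ⧸ N) => e ∈ T)
    have h3 := Finset.card_le_univ T
    simp only [Fintype.card_prod, Fintype.card_fin, hX, Fintype.card_coe] at h2 h3
    omega
  have h4 : ((Fintype.card {e : Fin r × (FreeGroup (Fin r) ⧸ N) // e ∉ T} : ℕ) : ℤ) + T.card
      = r * k := by exact_mod_cast h1
  have h5 : (T.card : ℤ) + 1 = k := by rw [hX] at hT; exact_mod_cast hT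
  linarith
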